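/- arXiv:2408.04128 — 3 statements merged into one kernel-verified Lean document; each statement's English description precedes it below -/
import Mathlib

section
/- Let A be an n×n complex matrix, s ≥ 0 an integer, i,j ∈ {1,…,n}, and set G := ( ⋃_{l=0}^{s} ( (i + S_l(A)) ∩ (j − S_{s−l}(A)) ) ) ∩ {1,…,n}. If both i ∈ G and j ∈ G, then the (i,j) entry of the matrix power A^s equals the corresponding entry of the s-th power of the principal submatrix indexed by G: [A^s]_{ij} = [(A[G,G])^s]_{𝕆(i),𝕆(j)}, where 𝕆 is the order bijection on G. -/
/-- The set of non-zero diagonal offsets of an `n × n` complex matrix `A`. -/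
def NDset (n : ℕ) (A : Matrix (Fin n) (Fin n) ℂ) : Set ℤ :=
  {r | ∃ i j : Fin n, (j : ℤ) - (i : ℤ) = r ∧ A i j ≠ 0}

/-- `S_0(A) = {0}` and, for `k ≥ 1`,
`S_k(A) = { z ∈ {-(n-1),…,n-1} : z = r_1 + ⋯ + r_k, r_t ∈ ND(A) }`. -/
def Sset (n : ℕ) (A : Matrix (Fin n) (Fin n) ℂ) : ℕ → Set ℤ
  | 0 => {0}
  | (k + 1) => {z | |z| ≤ (n : ℤ) - 1 ∧
      ∃ r : Fin (k + 1) → ℤ, (∀ t, r t ∈ NDset n A) ∧ z = ∑ t, r t}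

theorem sub_mem_Sset_iff {n : ℕ} {A : Matrix (Fin n) (Fin n) ℂ} {k : ℕ} {t u : Fin n} :
    (u : ℤ) - (t : ℤ) ∈ Sset n A k ↔
      ∃ r : Fin k → ℤ, (∀ x, r x ∈ NDset n A) ∧ (u : ℤ) - (t : ℤ) = ∑ x, r x := by
  cases k with
  | zero => simp [Sset]
  | succ k =>
    have h : |(u : ℤ) - (t : ℤ)| ≤ (n : ℤ) - 1 := by
      rw [abs_le]
      constructor <;> omega
    exact and_iff_right h

theorem sub_mem_Sset_succ_right {n : ℕ} {A : Matrix (Fin n) (Fin n) ℂ} {k : ℕ} {t u v : Fin n}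
    (h : (u : ℤ) - (t : ℤ) ∈ Sset n A k) (huv : A u v ≠ 0) :
    (v : ℤ) - (t : ℤ) ∈ Sset n A (k + 1) := by
  obtain ⟨r, hr, hsum⟩ := sub_mem_Sset_iff.mp h
  refine sub_mem_Sset_iff.mpr ⟨Fin.snoc r ((v : ℤ) - u), fun x => ?_, ?_⟩
  · refine Fin.lastCases ?_ (fun y => ?_) x
    · simpa using ⟨u, v, rfl, huv⟩
    · simpa using hr y
  · rw [Fin.sum_univ_castSucc]
    simp only [Fin.snoc_castSucc, Fin.snoc_last, ← hsum]
    ring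

theorem sub_mem_Sset_of_pow_ne_zero {n : ℕ} {A : Matrix (Fin n) (Fin n) ℂ} {k : ℕ}
    {t u : Fin n} (h : (A ^ k) t u ≠ 0) : (u : ℤ) - (t : ℤ) ∈ Sset n A k := by
  induction k generalizing u with
  | zero =>
    have htu : t = u := by
      by_contra hne
      exact h (by simp [Matrix.one_apply_ne hne])
    simp [htu, Sset]
  | succ k ih =>
    rw [pow_succ, Matrix.mul_apply] at h
    obtain ⟨v, -, hv⟩ := Finset.exists_ne_zero_of_sum_ne_zero h
    exact sub_mem_Sset_succ_right (ih (left_ne_zero_of_mul hv)) (right_ne_zero_of_mul hv)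

theorem pow_apply_eq_submatrix_pow_apply {n s : ℕ} {A : Matrix (Fin n) (Fin n) ℂ}
    {i j : Fin n} {G : Finset (Fin n)}
    (hG : ∀ t : Fin n, ∀ l ≤ s, (t : ℤ) - (i : ℤ) ∈ Sset n A l →
      (j : ℤ) - (t : ℤ) ∈ Sset n A (s - l) → t ∈ G)
    {κ : Type*} [Fintype κ] [DecidableEq κ] (e : κ ≃ G) {b : κ} (hb : (e b : Fin n) = j)
    {m : ℕ} (hm : m ≤ s) {a : κ} (ha : ((e a : Fin n) : ℤ) - (i : ℤ) ∈ Sset n A (s - m)) :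
    (A ^ m) (e a) j =
      ((A.submatrix (fun c => (e c : Fin n)) (fun c => (e c : Fin n))) ^ m) a b := by
  induction m generalizing a with
  | zero => simp [Matrix.one_apply, ← hb]
  | succ m ih =>
    have hstep : ∀ u, A (e a) u ≠ 0 → (u : ℤ) - (i : ℤ) ∈ Sset n A (s - m) := fun u hu => by
      have h := sub_mem_Sset_succ_right ha hu
      rwa [show s - (m + 1) + 1 = s - m by omega] at h
    rw [pow_succ', pow_succ', Matrix.mul_apply, Matrix.mul_apply]
    have hsupp : ∑ u, A (e a) u * (A ^ m) u j = ∑ u ∈ G, A (e a) u * (A ^ m) u j := by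
      refine (Finset.sum_subset (Finset.subset_univ G) fun u _ hu => ?_).symm
      by_contra hne
      refine hu (hG u (s - m) (by omega) (hstep u (left_ne_zero_of_mul hne)) ?_)
      rw [show s - (s - m) = m by omega]
      exact sub_mem_Sset_of_pow_ne_zero (right_ne_zero_of_mul hne)
    rw [hsupp, ← Finset.sum_coe_sort G, ← e.sum_comp]
    refine Finset.sum_congr rfl fun c _ => ?_
    rw [Matrix.submatrix_apply]
    by_cases hc : A (e a) (e c) = 0
    · simp [hc]
    · rw [ih (by omega) (hstep _ hc)]

/-- If `G = ( ⋃_{l=0}^{s} ((i + S_l(A)) ∩ (j − S_{s−l}(A))) ) ∩ {1,…,n}` contains both `i`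
and `j`, then `[A^s]_{ij} = [(A[G,G])^s]_{𝕆(i),𝕆(j)}` where `𝕆` is the order bijection
from `G` onto `{1,…,#G}`. -/
theorem pow_entry_eq_submatrix_pow_entry (n s : ℕ) (A : Matrix (Fin n) (Fin n) ℂ)
    (i j : Fin n) (G : Finset (Fin n))
    (hG : ∀ t : Fin n, t ∈ G ↔
      ∃ l ≤ s, (t : ℤ) - (i : ℤ) ∈ Sset n A l ∧ (j : ℤ) - (t : ℤ) ∈ Sset n A (s - l))
    (hi : i ∈ G) (hj : j ∈ G) :
    (A ^ s) i j =
      ((A.submatrix (fun a : Fin G.card => ((G.orderIsoOfFin rfl) a : Fin n))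
          (fun a : Fin G.card => ((G.orderIsoOfFin rfl) a : Fin n))) ^ s)
        ((G.orderIsoOfFin rfl).symm ⟨i, hi⟩) ((G.orderIsoOfFin rfl).symm ⟨j, hj⟩) := by
  have h := pow_apply_eq_submatrix_pow_apply (m := s) (a := (G.orderIsoOfFin rfl).symm ⟨i, hi⟩)
    (b := (G.orderIsoOfFin rfl).symm ⟨j, hj⟩)
    (fun t l hl h₁ h₂ => (hG t).mpr ⟨l, hl, h₁, h₂⟩) (G.orderIsoOfFin rfl).toEquiv
    (by simp) le_rfl (by simp [Sset])
  simpa using h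
end

section
/- Let A be an n×n complex matrix, k ≥ 0, and i,j ∈ {1,…,n}. If i ∉ Δ_{ij}^{(k)} or j ∉ Δ_{ij}^{(k)}, then for every polynomial p with complex coefficients of degree at most k, the (i,j) entry of p(A) (polynomial evaluation of p at the matrix A) is zero: [p(A)]_{ij} = 0. -/
/-- A non-zero entry of `A ^ s` has an offset that is a sum of `s` non-zero diagonal offsets. -/
theorem exists_sum_eq_offset_of_pow_apply_ne_zero (n : ℕ) (A : Matrix (Fin n) (Fin n) ℂ)
    (s : ℕ) (i j : Fin n) (h : (A ^ s) i j ≠ 0) :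
    ∃ r : Fin s → ℤ, (∀ t, r t ∈ NDset n A) ∧ (j : ℤ) - (i : ℤ) = ∑ t, r t := by
  induction s generalizing j with
  | zero =>
    have hij : i = j := by
      by_contra hne
      exact h (by rw [pow_zero, Matrix.one_apply_ne hne])
    exact ⟨Fin.elim0, fun t => t.elim0, by simp [hij]⟩
  | succ s ih =>
    rw [pow_succ, Matrix.mul_apply] at h
    obtain ⟨m, -, hm⟩ := Finset.exists_ne_zero_of_sum_ne_zero h
    obtain ⟨r, hr, hsum⟩ := ih m (left_ne_zero_of_mul hm)
    refine ⟨Fin.snoc r ((j : ℤ) - (m : ℤ)), fun t => ?_, ?_⟩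
    · induction t using Fin.lastCases with
      | last => simpa using ⟨m, j, rfl, right_ne_zero_of_mul hm⟩
      | cast t => simpa using hr t
    · rw [Fin.sum_univ_castSucc]
      simp only [Fin.snoc_castSucc, Fin.snoc_last]
      rw [← hsum]
      ring

/-- A non-zero `(i, j)` entry of `A ^ s` forces `j - i ∈ S_s(A)`. -/
theorem offset_mem_Sset_of_pow_apply_ne_zero (n : ℕ) (A : Matrix (Fin n) (Fin n) ℂ)
    (s : ℕ) (i j : Fin n) (h : (A ^ s) i j ≠ 0) : (j : ℤ) - (i : ℤ) ∈ Sset n A s := by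
  obtain ⟨r, hr, hsum⟩ := exists_sum_eq_offset_of_pow_apply_ne_zero n A s i j h
  cases s with
  | zero => simpa [Sset] using hsum
  | succ s =>
    refine ⟨?_, r, hr, hsum⟩
    have hi := i.isLt
    have hj := j.isLt
    rw [abs_le]
    omega

/-- If `i ∉ Δ_{ij}^{(k)}` or `j ∉ Δ_{ij}^{(k)}`, where
`Δ_{ij}^{(k)} = ( ⋃_{s=0}^{k} ⋃_{l=0}^{s} ((i + S_l(A)) ∩ (j − S_{s−l}(A))) ) ∩ {1,…,n}`,
then `[p(A)]_{ij} = 0` for every polynomial `p` of degree at most `k`. -/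
theorem poly_entry_eq_zero (n k : ℕ) (A : Matrix (Fin n) (Fin n) ℂ) (i j : Fin n)
    (Δ : Finset (Fin n))
    (hΔ : ∀ t : Fin n, t ∈ Δ ↔ ∃ s ≤ k, ∃ l ≤ s,
      (t : ℤ) - (i : ℤ) ∈ Sset n A l ∧ (j : ℤ) - (t : ℤ) ∈ Sset n A (s - l))
    (hij : i ∉ Δ ∨ j ∉ Δ)
    (p : Polynomial ℂ) (hp : p.natDegree ≤ k) :
    (Polynomial.aeval A) p i j = 0 := by
  have hpow : ∀ s ≤ k, (A ^ s) i j = 0 := by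
    intro s hs
    by_contra h
    have hmem := offset_mem_Sset_of_pow_apply_ne_zero n A s i j h
    rcases hij with hi | hj
    · exact hi ((hΔ i).2 ⟨s, hs, 0, s.zero_le, by simp [Sset], hmem⟩)
    · exact hj ((hΔ j).2 ⟨s, hs, s, le_rfl, hmem, by simp [Sset]⟩)
  rw [Polynomial.aeval_eq_sum_range, Matrix.sum_apply]
  refine Finset.sum_eq_zero fun s hs => ?_
  rw [Matrix.smul_apply, hpow s ((Nat.lt_succ_iff.1 (Finset.mem_range.1 hs)).trans hp), smul_zero]
end

section
/- (Entry formula for functions of symmetric tridiagonal Toeplitz matrices.) Let n ≥ 1 and b, c ∈ ℝ, and let T_n be the n×n real symmetric tridiagonal Toeplitz matrix with (T_n)_{ii} = c for all i, (T_n)_{i,i+1} = (T_n)_{i+1,i} = b for 1 ≤ i ≤ n−1, and all other entries zero. Then for every function f : ℝ → ℝ and all p, l ∈ {1,…,n}, [f(T_n)]_{pl} = (2/(n+1)) · Σ_{k=1}^{n} f( c + 2b·cos(kπ/(n+1)) ) · sin(kπp/(n+1)) · sin(kπl/(n+1)). -/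
/-- For a real symmetric matrix `A = U diag(λ₁,…,λₙ) Uᵀ` and `f : ℝ → ℝ`, the matrix
function `f(A) := U diag(f(λ₁),…,f(λₙ)) Uᵀ` (via Mathlib's spectral decomposition). -/
noncomputable def hermApply {n : ℕ} (A : Matrix (Fin n) (Fin n) ℝ) (hA : A.IsHermitian)
    (f : ℝ → ℝ) : Matrix (Fin n) (Fin n) ℝ :=
  (hA.eigenvectorUnitary : Matrix (Fin n) (Fin n) ℝ) *
    Matrix.diagonal (fun t => f (hA.eigenvalues t)) *
    star (hA.eigenvectorUnitary : Matrix (Fin n) (Fin n) ℝ)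

/-- If `A * V = V * diagonal μ` with `V * W = 1`, then `f(A) = V * diagonal (f ∘ μ) * W`. -/
theorem hermApply_eq_of_mul_eq {n : ℕ} {A V W : Matrix (Fin n) (Fin n) ℝ} (hA : A.IsHermitian)
    {μ : Fin n → ℝ} (hAV : A * V = V * Matrix.diagonal μ) (hVW : V * W = 1) (f : ℝ → ℝ) :
    hermApply A hA f = V * Matrix.diagonal (fun t => f (μ t)) * W := by
  set U : Matrix (Fin n) (Fin n) ℝ :=
    (hA.eigenvectorUnitary : Matrix (Fin n) (Fin n) ℝ) with hU
  have hUU : U * star U = 1 := Unitary.mul_star_self_of_mem hA.eigenvectorUnitary.2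
  have hUU' : star U * U = 1 := Unitary.star_mul_self_of_mem hA.eigenvectorUnitary.2
  have hspec : A = U * Matrix.diagonal hA.eigenvalues * star U := by
    simpa [Unitary.conjStarAlgAut_apply, Function.comp_def] using hA.spectral_theorem
  have hX : Matrix.diagonal hA.eigenvalues * (star U * V) = star U * V * Matrix.diagonal μ := by
    calc _ = star U * U * Matrix.diagonal hA.eigenvalues * (star U * V) := by
          rw [hUU', Matrix.one_mul]
      _ = star U * ((U * Matrix.diagonal hA.eigenvalues * star U) * V) := by
          simp only [Matrix.mul_assoc]
      _ = _ := by rw [← hspec, hAV, Matrix.mul_assoc]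
  have hfX : Matrix.diagonal (fun t => f (hA.eigenvalues t)) * (star U * V) =
      star U * V * Matrix.diagonal (fun t => f (μ t)) := by
    ext i j
    have h := congrFun (congrFun hX i) j
    rw [Matrix.diagonal_mul, Matrix.mul_diagonal] at h ⊢
    rcases eq_or_ne ((star U * V) i j) 0 with h0 | h0
    · simp [h0]
    · rw [mul_comm] at h
      rw [mul_left_cancel₀ h0 h, mul_comm]
  calc hermApply A hA f
      = U * (Matrix.diagonal (fun t => f (hA.eigenvalues t)) * (star U * V)) * W := by
        simp only [Matrix.mul_assoc, hVW, Matrix.mul_one, hermApply, hU]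
    _ = (U * star U) * V * Matrix.diagonal (fun t => f (μ t)) * W := by
        rw [hfX]; simp only [Matrix.mul_assoc]
    _ = _ := by rw [hUU, Matrix.one_mul]

/-- The telescoping form of the Dirichlet kernel. -/
theorem two_mul_sin_half_mul_sum_cos (n : ℕ) (x : ℝ) :
    2 * Real.sin (x / 2) * ∑ k ∈ Finset.range n, Real.cos ((k + 1) * x) =
      Real.sin (n * x + x / 2) - Real.sin (x / 2) := by
  induction n with
  | zero => simp
  | succ n ih =>
    rw [Finset.sum_range_succ, mul_add, ih, Nat.cast_succ,
      show (n : ℝ) * x + x / 2 = (n + 1) * x - x / 2 by ring, Real.sin_add, Real.sin_sub]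
    ring

theorem sum_cos_int_mul_pi_div (n : ℕ) (m : ℤ) (hm : m ≠ 0) (hlt : |m| < 2 * (n + 1)) :
    ∑ k ∈ Finset.range n, Real.cos ((k + 1) * (m * Real.pi / (n + 1))) =
      -((-1) ^ m + 1) / 2 := by
  have hN : (0 : ℝ) < n + 1 := by positivity
  set x : ℝ := m * Real.pi / (n + 1) with hx
  have hs : Real.sin (x / 2) ≠ 0 := by
    obtain ⟨h₁, h₂⟩ := abs_lt.mp hlt
    have h₁' : -(2 * (n + 1) : ℝ) < m := by exact_mod_cast h₁
    have h₂' : (m : ℝ) < 2 * (n + 1) := by exact_mod_cast h₂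
    have hx2 : x / 2 = m / (2 * (n + 1)) * Real.pi := by rw [hx]; field_simp
    rw [Ne, Real.sin_eq_zero_iff_of_lt_of_lt, hx2]
    · have : (m : ℝ) ≠ 0 := by exact_mod_cast hm
      positivity
    · rw [hx2, ← neg_one_mul]
      gcongr
      rw [lt_div_iff₀ (by positivity)]
      linarith
    · rw [hx2]
      refine mul_lt_of_lt_one_left Real.pi_pos ?_
      rw [div_lt_one (by positivity)]
      exact h₂'
  have h := two_mul_sin_half_mul_sum_cos n x
  rw [show (n : ℝ) * x + x / 2 = m * Real.pi - x / 2 by rw [hx]; field_simp; ring,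
    Real.sin_int_mul_pi_sub] at h
  apply mul_left_cancel₀ (mul_ne_zero two_ne_zero hs)
  rw [h]
  ring

/-- The discrete sine transform matrix, with eigenvectors of tridiagonal Toeplitz matrices
as columns. -/
noncomputable def sineMatrix (n : ℕ) : Matrix (Fin n) (Fin n) ℝ :=
  Matrix.of fun i k => Real.sin ((k + 1) * Real.pi * (i + 1) / (n + 1))

theorem sineMatrix_mul_transpose (n : ℕ) :
    sineMatrix n * (sineMatrix n).transpose = ((n + 1 : ℝ) / 2) • 1 := by
  ext i j
  have hi := i.2
  have hj := j.2
  have hterm (k : ℕ) : Real.sin ((k + 1) * Real.pi * (i + 1) / (n + 1)) *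
        Real.sin ((k + 1) * Real.pi * (j + 1) / (n + 1)) =
      (Real.cos ((k + 1) * (((i - j : ℤ) : ℝ) * Real.pi / (n + 1))) -
        Real.cos ((k + 1) * (((i + j + 2 : ℤ) : ℝ) * Real.pi / (n + 1)))) / 2 := by
    have h₁ : (k + 1) * (((i - j : ℤ) : ℝ) * Real.pi / (n + 1)) =
      (k + 1) * Real.pi * (i + 1) / (n + 1) - (k + 1) * Real.pi * (j + 1) / (n + 1) := by
      push_cast; ring
    have h₂ : (k + 1) * (((i + j + 2 : ℤ) : ℝ) * Real.pi / (n + 1)) =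
      (k + 1) * Real.pi * (i + 1) / (n + 1) + (k + 1) * Real.pi * (j + 1) / (n + 1) := by
      push_cast; ring
    rw [h₁, h₂, Real.cos_sub, Real.cos_add]
    ring
  simp only [Matrix.mul_apply, sineMatrix, Matrix.transpose_apply, Matrix.of_apply, hterm,
    Matrix.smul_apply, smul_eq_mul]
  rw [Fin.sum_univ_eq_sum_range (fun k : ℕ =>
      (Real.cos ((k + 1) * (((i - j : ℤ) : ℝ) * Real.pi / (n + 1))) -
        Real.cos ((k + 1) * (((i + j + 2 : ℤ) : ℝ) * Real.pi / (n + 1)))) / 2) n,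
    ← Finset.sum_div, Finset.sum_sub_distrib,
    sum_cos_int_mul_pi_div n (i + j + 2) (by omega) (by rw [abs_lt]; omega)]
  rcases eq_or_ne i j with rfl | hij
  · have : Even ((i : ℤ) + i + 2) := ⟨i + 1, by ring⟩
    simp [this.neg_one_zpow]
  · have hne : (i : ℕ) ≠ j := Fin.val_ne_of_ne hij
    rw [sum_cos_int_mul_pi_div n (i - j) (by omega) (by rw [abs_lt]; omega),
      show (i : ℤ) + j + 2 = (i - j) + 2 * (j + 1) by ring, zpow_add₀ (by norm_num),
      (even_two_mul ((j : ℤ) + 1)).neg_one_zpow, Matrix.one_apply_ne hij]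
    ring

/-- The action of a tridiagonal Toeplitz matrix on the interior values of a sequence vanishing at
both ends. -/
theorem sum_tridiag_mul {n : ℕ} (b c : ℝ) (g : ℕ → ℝ) (h0 : g 0 = 0) (hlast : g (n + 1) = 0)
    (i : Fin n) :
    ∑ j : Fin n, (if (i : ℤ) = (j : ℤ) then c else if |(i : ℤ) - (j : ℤ)| = 1 then b else 0) *
      g (j + 1) = c * g (i + 1) + b * (g i + g (i + 2)) := by
  have hi := i.2
  have hsplit (j : ℕ) : (if (i : ℤ) = (j : ℤ) then c else
        if |(i : ℤ) - (j : ℤ)| = 1 then b else 0) * g (j + 1) =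
      (if (i : ℕ) = j then c * g (j + 1) else 0) + (if (i : ℕ) = j + 1 then b * g (j + 1) else 0) +
        (if (i : ℕ) + 1 = j then b * g (j + 1) else 0) := by
    simp only [abs_eq (zero_le_one' ℤ)]
    split_ifs <;> first | omega | simp
  simp only [hsplit]
  rw [Fin.sum_univ_eq_sum_range (fun j : ℕ => (if (i : ℕ) = j then c * g (j + 1) else 0) +
      (if (i : ℕ) = j + 1 then b * g (j + 1) else 0) +
        (if (i : ℕ) + 1 = j then b * g (j + 1) else 0)) n,
    Finset.sum_add_distrib, Finset.sum_add_distrib, Finset.sum_ite_eq, Finset.sum_ite_eq]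
  have hlow : ∑ j ∈ Finset.range n, (if (i : ℕ) = j + 1 then b * g (j + 1) else 0) = b * g i := by
    have h := Finset.sum_range_succ' (fun j : ℕ => if (i : ℕ) = j then b * g j else 0) n
    rw [Finset.sum_ite_eq, if_pos (Finset.mem_range.mpr (by omega))] at h
    simpa [h0] using h.symm
  have hhigh : (if (i : ℕ) + 1 ∈ Finset.range n then b * g (i + 1 + 1) else 0) =
      b * g (i + 2) := by
    split_ifs with h
    · rfl
    · rw [Finset.mem_range] at h
      rw [show (i : ℕ) + 2 = n + 1 by omega, hlast, mul_zero]
  rw [hlow, hhigh, if_pos (Finset.mem_range.mpr hi)]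
  ring

theorem tridiag_mul_sineMatrix {n : ℕ} {b c : ℝ} {T : Matrix (Fin n) (Fin n) ℝ}
    (hT : ∀ i j : Fin n, T i j =
      if (i : ℤ) = (j : ℤ) then c else if |(i : ℤ) - (j : ℤ)| = 1 then b else 0) :
    T * sineMatrix n = sineMatrix n * Matrix.diagonal fun k : Fin n =>
      c + 2 * b * Real.cos ((k + 1) * Real.pi / (n + 1)) := by
  ext i k
  have hN : (n + 1 : ℝ) ≠ 0 := by positivity
  have h := sum_tridiag_mul b c (fun m : ℕ => Real.sin ((k + 1) * Real.pi * m / (n + 1)))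
    (by simp) (by
      push_cast
      rw [mul_div_cancel_right₀ _ hN]
      exact_mod_cast Real.sin_nat_mul_pi (k + 1)) i
  rw [Matrix.mul_diagonal, Matrix.mul_apply]
  simp only [sineMatrix, Matrix.of_apply, hT]
  push_cast at h
  rw [h]
  set x : ℝ := (k + 1) * Real.pi * (i + 1) / (n + 1) with hx
  set y : ℝ := (k + 1) * Real.pi / (n + 1) with hy
  rw [show (k + 1) * Real.pi * (i : ℝ) / (n + 1) = x - y by rw [hx, hy]; ring,
    show (k + 1) * Real.pi * ((i : ℝ) + 2) / (n + 1) = x + y by rw [hx, hy]; ring,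
    Real.sin_sub, Real.sin_add]
  ring

/-- Entry formula for functions of symmetric tridiagonal Toeplitz matrices: if `T` is the
`n × n` real symmetric tridiagonal Toeplitz matrix with diagonal `c` and off-diagonal `b`,
then for every `f : ℝ → ℝ` and all one-based indices `p, l ∈ {1,…,n}` (represented by
`p l : Fin n` standing for `p+1, l+1`),
`[f(T)]_{pl} = (2/(n+1)) Σ_{k=1}^{n} f(c + 2b cos(kπ/(n+1))) sin(kπp/(n+1)) sin(kπl/(n+1))`. -/
theorem tridiag_toeplitz_entry (n : ℕ) (hn : 1 ≤ n) (b c : ℝ)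
    (T : Matrix (Fin n) (Fin n) ℝ)
    (hT : ∀ i j : Fin n, T i j =
      if (i : ℤ) = (j : ℤ) then c else if |(i : ℤ) - (j : ℤ)| = 1 then b else 0)
    (hherm : T.IsHermitian) (f : ℝ → ℝ) (p l : Fin n) :
    hermApply T hherm f p l =
      (2 / (n + 1)) * ∑ k ∈ Finset.range n,
        f (c + 2 * b * Real.cos ((k + 1) * Real.pi / (n + 1))) *
          Real.sin ((k + 1) * Real.pi * ((p : ℕ) + 1) / (n + 1)) *
          Real.sin ((k + 1) * Real.pi * ((l : ℕ) + 1) / (n + 1)) := by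
  have hN : (n + 1 : ℝ) ≠ 0 := by positivity
  have hVW : sineMatrix n * ((2 / (n + 1 : ℝ)) • (sineMatrix n).transpose) = 1 := by
    rw [Matrix.mul_smul, sineMatrix_mul_transpose, smul_smul]
    field_simp
    exact one_smul _ _
  rw [hermApply_eq_of_mul_eq hherm (tridiag_mul_sineMatrix hT) hVW, Matrix.mul_smul,
    Matrix.smul_apply, smul_eq_mul, Matrix.mul_apply, ← Fin.sum_univ_eq_sum_range (fun k : ℕ =>
      f (c + 2 * b * Real.cos ((k + 1) * Real.pi / (n + 1))) *
        Real.sin ((k + 1) * Real.pi * ((p : ℕ) + 1) / (n + 1)) *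
        Real.sin ((k + 1) * Real.pi * ((l : ℕ) + 1) / (n + 1)))]
  congr 1
  refine Finset.sum_congr rfl fun k _ => ?_
  rw [Matrix.mul_diagonal, Matrix.transpose_apply, sineMatrix, Matrix.of_apply, Matrix.of_apply]
  ring
end
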